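/- arXiv:1506.09147 — 8 statements merged into one kernel-verified Lean document; each statement's English description precedes it below -/
import Mathlib

section
/- In the group G₄, the center is exactly the set {(0,0,0,t) : t ∈ ℝ} and the commutator subgroup is exactly the set {(0,0,s,t) : s,t ∈ ℝ}. -/
/-- The 4-dimensional elementary filiform Lie group `F₄`, realized on `ℝ⁴` with the
multiplication `(x₁,x₂,x₃,x₄)·(y₁,y₂,y₃,y₄) =
(x₁+y₁, x₂+y₂, x₃+y₃ − x₂y₁, x₄+y₄ − y₁x₃ + ½ x₂y₁²)`. -/
@[ext] structure G4 where
  x1 : ℝ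
  x2 : ℝ
  x3 : ℝ
  x4 : ℝ

namespace G4

noncomputable instance : Mul G4 :=
  ⟨fun p q => ⟨p.x1 + q.x1, p.x2 + q.x2, p.x3 + q.x3 - p.x2 * q.x1,
    p.x4 + q.x4 - q.x1 * p.x3 + (1/2) * p.x2 * q.x1 ^ 2⟩⟩

instance : One G4 := ⟨⟨0, 0, 0, 0⟩⟩

noncomputable instance : Inv G4 :=
  ⟨fun p => ⟨-p.x1, -p.x2, -p.x3 - p.x2 * p.x1,
    -p.x4 - p.x1 * p.x3 - (1/2) * p.x2 * p.x1 ^ 2⟩⟩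

theorem mul_def (p q : G4) : p * q =
    ⟨p.x1 + q.x1, p.x2 + q.x2, p.x3 + q.x3 - p.x2 * q.x1,
      p.x4 + q.x4 - q.x1 * p.x3 + (1/2) * p.x2 * q.x1 ^ 2⟩ := rfl

theorem one_def : (1 : G4) = ⟨0, 0, 0, 0⟩ := rfl

theorem inv_def (p : G4) : p⁻¹ =
    ⟨-p.x1, -p.x2, -p.x3 - p.x2 * p.x1,
      -p.x4 - p.x1 * p.x3 - (1/2) * p.x2 * p.x1 ^ 2⟩ := rfl

noncomputable instance : Group G4 where
  mul_assoc p q r := by ext <;> (simp only [mul_def]; ring)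
  one_mul p := by ext <;> (simp only [mul_def, one_def]; ring)
  mul_one p := by ext <;> (simp only [mul_def, one_def]; ring)
  inv_mul_cancel p := by ext <;> (simp only [mul_def, one_def, inv_def]; ring)

end G4

namespace G4

theorem mem_center_iff {g : G4} :
    g ∈ Subgroup.center G4 ↔ ∃ t : ℝ, g = ⟨0, 0, 0, t⟩ := by
  rw [Subgroup.mem_center_iff]
  constructor
  · intro h
    have h₁ := h ⟨1, 0, 0, 0⟩
    have h₂ := h ⟨0, 1, 0, 0⟩
    simp only [mul_def, G4.mk.injEq] at h₁ h₂
    obtain ⟨-, -, h₁₃, h₁₄⟩ := h₁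
    obtain ⟨-, -, h₂₃, -⟩ := h₂
    have hx2 : g.x2 = 0 := by linarith
    rw [hx2] at h₁₄
    refine ⟨g.x4, ?_⟩
    ext <;> dsimp only <;> linarith
  · rintro ⟨t, rfl⟩ h
    ext <;> (simp only [mul_def]; ring)

/-- The subgroup `{(0,0,s,t) : s,t ∈ ℝ}` of `G4`. -/
def lastTwo : Subgroup G4 where
  carrier := {g | ∃ s t : ℝ, g = ⟨0, 0, s, t⟩}
  one_mem' := ⟨0, 0, rfl⟩
  mul_mem' := by
    rintro _ _ ⟨s, t, rfl⟩ ⟨s', t', rfl⟩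
    exact ⟨s + s', t + t', by simp [mul_def]⟩
  inv_mem' := by
    rintro _ ⟨s, t, rfl⟩
    exact ⟨-s, -t, by simp [inv_def]⟩

theorem commutator_mem_lastTwo (a b : G4) : a⁻¹ * b⁻¹ * a * b ∈ lastTwo := by
  refine ⟨(a⁻¹ * b⁻¹ * a * b).x3, (a⁻¹ * b⁻¹ * a * b).x4, ?_⟩
  ext
  · simp only [mul_def, inv_def]; ring
  · simp only [mul_def, inv_def]; ring
  · rfl
  · rfl

theorem exists_eq_commutator (s t : ℝ) :
    ∃ a b : G4, (⟨0, 0, s, t⟩ : G4) = a⁻¹ * b⁻¹ * a * b := by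
  refine ⟨⟨1, 0, 0, 0⟩, ⟨0, s, t + s / 2, 0⟩, ?_⟩
  ext <;> (simp only [mul_def, inv_def]; ring)

theorem closure_commutators :
    Subgroup.closure {x : G4 | ∃ a b : G4, x = a⁻¹ * b⁻¹ * a * b} = lastTwo := by
  apply le_antisymm
  · rw [Subgroup.closure_le]
    rintro _ ⟨a, b, rfl⟩
    exact commutator_mem_lastTwo a b
  · rintro _ ⟨s, t, rfl⟩
    exact Subgroup.subset_closure (exists_eq_commutator s t)

end G4

/-- In the group `G₄`, the center is exactly `{(0,0,0,t) : t ∈ ℝ}` and the commutator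
subgroup (the subgroup generated by all commutators `a⁻¹b⁻¹ab`) is exactly
`{(0,0,s,t) : s,t ∈ ℝ}`. -/
theorem g4_center_and_commutator :
    ((Subgroup.center G4 : Set G4) = {g : G4 | ∃ t : ℝ, g = ⟨0, 0, 0, t⟩}) ∧
    ((Subgroup.closure {x : G4 | ∃ a b : G4, x = a⁻¹ * b⁻¹ * a * b} : Set G4) =
      {g : G4 | ∃ s t : ℝ, g = ⟨0, 0, s, t⟩}) := by
  refine ⟨Set.ext fun g => G4.mem_center_iff, ?_⟩
  rw [G4.closure_commutators]
  rfl
end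

section
/- Let f : ℝ³ → ℝ be a continuous function with f(0,0,0) = 0. Then the following are equivalent: (i) for every (x₁,y₁,z₁) and (x₂,y₂,z₂) in ℝ³ there exists exactly one quadruple (x,y,z,t) ∈ ℝ³ × ℝ such that (x, y, f(x,y,z), z)·(x₁, y₁, 0, z₁) = (x₂, y₂, 0, z₂)·(0, 0, t, 0) holds in G₄; (ii) f does not depend on its third variable, i.e. f(x,y,z) = f(x,y,z′) for all x, y, z, z′. -/
/-- The multiplication of the 4-dimensional elementary filiform Lie group `F₄`,
realized on `ℝ⁴`. -/
noncomputable def g4mul (x y : ℝ × ℝ × ℝ × ℝ) : ℝ × ℝ × ℝ × ℝ :=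
  (x.1 + y.1, x.2.1 + y.2.1, x.2.2.1 + y.2.2.1 - x.2.1 * y.1,
    x.2.2.2 + y.2.2.2 - y.1 * x.2.2.1 + (1/2) * x.2.1 * y.1 ^ 2)

/-- Let `f : ℝ³ → ℝ` be continuous with `f(0,0,0) = 0`.  The section
`g(x,y,0,z)H₁ ↦ g(x,y,f(x,y,z),z)` with respect to `H₁ = {(0,0,v,0)}` is sharply
transitive (i.e. for all `(x₁,y₁,z₁)`, `(x₂,y₂,z₂)` there is exactly one quadruple
`(x,y,z,t)` with `(x,y,f(x,y,z),z)·(x₁,y₁,0,z₁) = (x₂,y₂,0,z₂)·(0,0,t,0)`) if and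
only if `f` does not depend on its third variable. -/
theorem sharply_transitive_iff_independent_of_z
    (f : ℝ × ℝ × ℝ → ℝ) (hf : Continuous f) (hf0 : f (0, 0, 0) = 0) :
    (∀ x₁ y₁ z₁ x₂ y₂ z₂ : ℝ, ∃! w : (ℝ × ℝ × ℝ) × ℝ,
      g4mul (w.1.1, w.1.2.1, f w.1, w.1.2.2) (x₁, y₁, 0, z₁) =
        g4mul (x₂, y₂, 0, z₂) (0, 0, w.2, 0)) ↔
    (∀ x y z z' : ℝ, f (x, y, z) = f (x, y, z')) := by
  simp only [g4mul, Prod.mk.injEq]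
  constructor
  · intro h x y z z'
    by_contra hne
    have hd : f (x, y, z) - f (x, y, z') ≠ 0 := sub_ne_zero.mpr hne
    -- with this slope `a`, the map `z ↦ z - a * f (x, y, z)` identifies `z` and `z'`
    obtain ⟨a, ha⟩ : ∃ a : ℝ, a * (f (x, y, z) - f (x, y, z')) = z - z' :=
      ⟨_, div_mul_cancel₀ _ hd⟩
    have hw := (h a 0 0 (x + a) y (z - a * f (x, y, z) + (1/2) * y * a ^ 2)).unique
      (y₁ := ((x, y, z), f (x, y, z) - y * a)) (y₂ := ((x, y, z'), f (x, y, z') - y * a))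
      (by refine ⟨?_, ?_, ?_, ?_⟩ <;> ring)
      (by refine ⟨?_, ?_, ?_, ?_⟩ <;> linarith)
    simp only [Prod.mk.injEq, true_and] at hw
    exact hne (by rw [hw.1])
  · intro h x₁ y₁ z₁ x₂ y₂ z₂
    refine ⟨((x₂ - x₁, y₂ - y₁, z₂ - z₁ + x₁ * f (x₂ - x₁, y₂ - y₁, 0)
      - (1/2) * (y₂ - y₁) * x₁ ^ 2), f (x₂ - x₁, y₂ - y₁, 0) - (y₂ - y₁) * x₁), ?_, ?_⟩
    · dsimp only
      rw [h _ _ _ 0]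
      refine ⟨?_, ?_, ?_, ?_⟩ <;> ring
    · rintro ⟨⟨x, y, z⟩, t⟩ ⟨hx, hy, ht, hz⟩
      dsimp only at hx hy ht hz
      obtain rfl : x = x₂ - x₁ := by linarith
      obtain rfl : y = y₂ - y₁ := by linarith
      rw [h _ _ z 0] at ht hz
      simp only [Prod.mk.injEq, true_and]
      constructor <;> linarith
end

section
/- Let f : ℝ² → ℝ be a continuous function with f(0,0) = 0. Then the binary operation on ℝ³ defined by (x₁,y₁,z₁) ∗ (x₂,y₂,z₂) = (x₁+x₂, y₁+y₂, z₁+z₂ − x₂·f(x₁,y₁) + (1/2)x₂²·y₁) is a topological loop multiplication with identity (0,0,0): the operation is continuous, (0,0,0) is a two-sided identity, and for all a, b ∈ ℝ³ each of the equations a ∗ y = b and x ∗ a = b has exactly one solution. -/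
/-- The loop multiplication on `ℝ³` determined by a continuous function `f : ℝ² → ℝ`:
`(x₁,y₁,z₁) ∗ (x₂,y₂,z₂) = (x₁+x₂, y₁+y₂, z₁+z₂ − x₂·f(x₁,y₁) + ½ x₂²·y₁)`. -/
noncomputable def loopMul (f : ℝ × ℝ → ℝ) (p q : ℝ × ℝ × ℝ) : ℝ × ℝ × ℝ :=
  (p.1 + q.1, p.2.1 + q.2.1,
    p.2.2 + q.2.2 - q.1 * f (p.1, p.2.1) + (1/2) * q.1 ^ 2 * p.2.1)

/-- For every continuous `f : ℝ² → ℝ` with `f(0,0) = 0` the operation `loopMul f` is a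
topological loop multiplication on `ℝ³` with identity `(0,0,0)`: it is continuous,
`(0,0,0)` is a two-sided identity, and the equations `a ∗ y = b` and `x ∗ a = b` have
exactly one solution for all `a, b`. -/
theorem loopMul_is_topological_loop (f : ℝ × ℝ → ℝ) (hf : Continuous f)
    (hf0 : f (0, 0) = 0) :
    Continuous (fun p : (ℝ × ℝ × ℝ) × (ℝ × ℝ × ℝ) => loopMul f p.1 p.2) ∧
    (∀ a : ℝ × ℝ × ℝ, loopMul f (0, 0, 0) a = a ∧ loopMul f a (0, 0, 0) = a) ∧
    (∀ a b : ℝ × ℝ × ℝ,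
      (∃! y : ℝ × ℝ × ℝ, loopMul f a y = b) ∧ (∃! x : ℝ × ℝ × ℝ, loopMul f x a = b)) := by
  refine ⟨by unfold loopMul; fun_prop, fun a => ?_, fun a b => ⟨?_, ?_⟩⟩
  · simp [loopMul, hf0]
  · obtain ⟨a₁, a₂, a₃⟩ := a
    obtain ⟨b₁, b₂, b₃⟩ := b
    refine ⟨(b₁ - a₁, b₂ - a₂,
      b₃ - a₃ + (b₁ - a₁) * f (a₁, a₂) - (1/2) * (b₁ - a₁) ^ 2 * a₂), ?_, ?_⟩
    · simp only [loopMul, Prod.mk.injEq]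
      refine ⟨?_, ?_, ?_⟩ <;> ring
    · rintro ⟨y₁, y₂, y₃⟩ h
      simp only [loopMul, Prod.mk.injEq] at h ⊢
      obtain ⟨rfl, rfl, rfl⟩ := h
      refine ⟨?_, ?_, ?_⟩ <;> ring
  · obtain ⟨a₁, a₂, a₃⟩ := a
    obtain ⟨b₁, b₂, b₃⟩ := b
    refine ⟨(b₁ - a₁, b₂ - a₂,
      b₃ - a₃ + a₁ * f (b₁ - a₁, b₂ - a₂) - (1/2) * a₁ ^ 2 * (b₂ - a₂)), ?_, ?_⟩
    · simp only [loopMul, Prod.mk.injEq]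
      refine ⟨?_, ?_, ?_⟩ <;> ring
    · rintro ⟨x₁, x₂, x₃⟩ h
      simp only [loopMul, Prod.mk.injEq] at h ⊢
      obtain ⟨rfl, rfl, rfl⟩ := h
      simp only [add_sub_cancel_right, true_and]
      ring
end

section
/- Let f : ℝ² → ℝ be a continuous function with f(0,0) = 0. Then the subgroup of G₄ generated by the set {(x, y, f(x,y), z) : x, y, z ∈ ℝ} is the whole group G₄. -/
/-- For every continuous `f : ℝ² → ℝ` with `f(0,0) = 0`, the subgroup of `G₄` generated
by the image `{(x, y, f(x,y), z) : x, y, z ∈ ℝ}` of the section determined by `f` is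
the whole group `G₄`. -/
theorem section_generates_G4 (f : ℝ × ℝ → ℝ) (hf : Continuous f)
    (hf0 : f (0, 0) = 0) :
    Subgroup.closure {g : G4 | ∃ x y z : ℝ, g = ⟨x, y, f (x, y), z⟩} = ⊤ := by
  set H := Subgroup.closure {g : G4 | ∃ x y z : ℝ, g = ⟨x, y, f (x, y), z⟩}
  have section_mem (x y z : ℝ) : (⟨x, y, f (x, y), z⟩ : G4) ∈ H :=
    Subgroup.subset_closure ⟨x, y, z, rfl⟩
  have center_mem (z : ℝ) : (⟨0, 0, 0, z⟩ : G4) ∈ H := by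
    simpa [hf0] using section_mem 0 0 z
  -- Commutators of section points cover the third coordinate; the centre then adjusts the fourth.
  have derived_mem (t z : ℝ) : (⟨0, 0, t, z⟩ : G4) ∈ H := by
    set p : G4 := ⟨t, 0, f (t, 0), 0⟩ with hp
    set q : G4 := ⟨0, 1, f (0, 1), 0⟩ with hq
    have hpm : p ∈ H := section_mem t 0 0
    have hqm : q ∈ H := section_mem 0 1 0
    have hcm : p * q * p⁻¹ * q⁻¹ ∈ H :=
      H.mul_mem (H.mul_mem (H.mul_mem hpm hqm) (H.inv_mem hpm)) (H.inv_mem hqm)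
    convert H.mul_mem hcm (center_mem (z - (p * q * p⁻¹ * q⁻¹).x4)) using 1
    ext <;> simp only [hp, hq, G4.mul_def, G4.inv_def] <;> ring
  refine (Subgroup.eq_top_iff' H).2 fun g => ?_
  convert H.mul_mem (section_mem g.x1 g.x2 0) (derived_mem (g.x3 - f (g.x1, g.x2)) g.x4) using 1
  ext <;> simp only [G4.mul_def] <;> ring
end

section
/- Let h : ℝ³ → ℝ be a continuous function with h(0,0,0) = 0. Then the following are equivalent: (i) for every (x₁,y₁,z₁) and (x₂,y₂,z₂) in ℝ³ there exists exactly one quadruple (x,y,z,t) ∈ ℝ³ × ℝ such that (h(x,y,z), x, y − x·h(x,y,z), z − y·h(x,y,z) + (1/2)x·h(x,y,z)²)·(0, x₁, y₁, z₁) = (0, x₂, y₂, z₂)·(t, 0, 0, 0) holds in G₄; (ii) h depends only on its first variable, i.e. h(x,y,z) = h(x,0,0) for all x, y, z. -/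
/-- The defining equation of sharp transitivity in coordinates, with `u` the value of the
section at `(x, y, z)`. -/
lemma g4mul_section_eq_iff (u x y z t x₁ y₁ z₁ x₂ y₂ z₂ : ℝ) :
    g4mul (u, x, y - x * u, z - y * u + (1/2) * x * u ^ 2) (0, x₁, y₁, z₁)
        = g4mul (0, x₂, y₂, z₂) (t, 0, 0, 0) ↔
      t = u ∧ x = x₂ - x₁ ∧ y = y₂ - y₁ - x₁ * u ∧
        z = z₂ - z₁ - y₁ * u - (1/2) * x₁ * u ^ 2 := by
  simp only [g4mul, Prod.mk.injEq]
  constructor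
  · rintro ⟨h1, h2, h3, h4⟩
    obtain rfl : t = u := by linarith
    obtain rfl : x₂ = x + x₁ := by linarith
    obtain rfl : y₂ = y + y₁ + x₁ * t := by linarith
    refine ⟨rfl, by ring, by ring, by linarith⟩
  · rintro ⟨rfl, rfl, rfl, rfl⟩
    refine ⟨by ring, by ring, by ring, by ring⟩

/-- Two points with distinct `u`-coordinates lie on a common curve
`u ↦ (c - a u, d - b u - a u² / 2)`. -/
lemma exists_curve_through_two_points {u v : ℝ} (huv : u ≠ v) (y z y' z' : ℝ) :
    ∃ a b c d : ℝ, (y = c - a * u ∧ z = d - b * u - (1/2) * a * u ^ 2) ∧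
      (y' = c - a * v ∧ z' = d - b * v - (1/2) * a * v ^ 2) := by
  have hne : v - u ≠ 0 := sub_ne_zero.mpr huv.symm
  obtain ⟨a, ha⟩ : ∃ a, a * (v - u) = y - y' := ⟨_, div_mul_cancel₀ _ hne⟩
  obtain ⟨b, hb⟩ : ∃ b, b * (v - u) = z - z' + (1/2) * a * (u ^ 2 - v ^ 2) :=
    ⟨_, div_mul_cancel₀ _ hne⟩
  exact ⟨a, b, y + a * u, z + b * u + (1/2) * a * u ^ 2,
    ⟨by ring, by ring⟩, by linarith, by linarith⟩

/-- Let `h : ℝ³ → ℝ` be continuous with `h(0,0,0) = 0`.  The section determined by `h`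
with respect to the subgroup `H₂ = {(v,0,0,0)}` is sharply transitive (i.e. for all
`(x₁,y₁,z₁)`, `(x₂,y₂,z₂)` there is exactly one quadruple `(x,y,z,t)` with
`(h(x,y,z), x, y − x·h(x,y,z), z − y·h(x,y,z) + ½ x·h(x,y,z)²)·(0,x₁,y₁,z₁)
  = (0,x₂,y₂,z₂)·(t,0,0,0)`) if and only if `h` depends only on its first variable. -/
theorem sharply_transitive_iff_depends_only_on_x
    (h : ℝ × ℝ × ℝ → ℝ) (hh : Continuous h) (hh0 : h (0, 0, 0) = 0) :
    (∀ x₁ y₁ z₁ x₂ y₂ z₂ : ℝ, ∃! w : (ℝ × ℝ × ℝ) × ℝ,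
      g4mul (h w.1, w.1.1, w.1.2.1 - w.1.1 * h w.1,
          w.1.2.2 - w.1.2.1 * h w.1 + (1/2) * w.1.1 * (h w.1) ^ 2)
        (0, x₁, y₁, z₁) = g4mul (0, x₂, y₂, z₂) (w.2, 0, 0, 0)) ↔
    (∀ x y z : ℝ, h (x, y, z) = h (x, 0, 0)) := by
  constructor
  · intro H x y z
    by_contra hne
    obtain ⟨a, b, c, d, ⟨hy, hz⟩, hy', hz'⟩ := exists_curve_through_two_points hne y z 0 0
    have key := (H a b 0 (x + a) (c + b) d).unique
      (y₁ := ((x, y, z), h (x, y, z))) (y₂ := ((x, 0, 0), h (x, 0, 0)))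
      ((g4mul_section_eq_iff ..).2 ⟨rfl, by ring, by linarith, by linarith⟩)
      ((g4mul_section_eq_iff ..).2 ⟨rfl, by ring, by linarith, by linarith⟩)
    exact hne (congrArg Prod.snd key)
  · intro H x₁ y₁ z₁ x₂ y₂ z₂
    set u := h (x₂ - x₁, 0, 0) with hu
    refine ⟨((x₂ - x₁, y₂ - y₁ - x₁ * u, z₂ - z₁ - y₁ * u - (1/2) * x₁ * u ^ 2), u),
      (g4mul_section_eq_iff ..).2 ?_, ?_⟩
    · simp only [H (x₂ - x₁) (_ - _) (_ - _), ← hu, and_self]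
    · rintro ⟨⟨x, y, z⟩, t⟩ hw
      obtain ⟨ht, hx, hy, hz⟩ := (g4mul_section_eq_iff ..).1 hw
      have hxu : h (x, y, z) = u := by rw [H, hu, ← hx]
      simp only [hxu] at ht hy hz
      simp only [Prod.mk.injEq]
      exact ⟨⟨hx, hy, hz⟩, ht⟩
end

section
/- Let h : ℝ → ℝ be a continuous function with h(0) = 0. Then the subgroup of G₄ generated by the set {(h(x), x, y − x·h(x), z − y·h(x) + (1/2)x·h(x)²) : x, y, z ∈ ℝ} equals the whole group G₄ if and only if h is non-linear, i.e. there is no λ ∈ ℝ with h(x) = λx for all x. -/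
namespace G4

/-- A subgroup of `G₄` containing every `(0, 0, u, v)` is saturated with respect to the
last two coordinates. -/
theorem mk_mem_of_mem {K : Subgroup G4} (hK : ∀ u v : ℝ, (⟨0, 0, u, v⟩ : G4) ∈ K)
    {p : G4} (hp : p ∈ K) (u v : ℝ) : (⟨p.x1, p.x2, u, v⟩ : G4) ∈ K := by
  have h := K.mul_mem hp (hK (u - p.x3) (v - p.x4))
  simpa [mul_def] using h

/-- The additive group of those `t` with `(t, 0, 0, 0) ∈ K`. -/
def firstAxis (K : Subgroup G4) : AddSubgroup ℝ where
  carrier := {t | (⟨t, 0, 0, 0⟩ : G4) ∈ K}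
  zero_mem' := K.one_mem
  add_mem' {a b} ha hb := by
    simpa [mul_def] using K.mul_mem ha hb
  neg_mem' {a} ha := by
    simpa [inv_def] using K.inv_mem ha

theorem mem_firstAxis {K : Subgroup G4} {t : ℝ} :
    t ∈ firstAxis K ↔ (⟨t, 0, 0, 0⟩ : G4) ∈ K := Iff.rfl

/-- The subgroup of `G₄` consisting of the elements with `x₁ = λ x₂`. -/
def linearSubgroup (lam : ℝ) : Subgroup G4 where
  carrier := {g | g.x1 = lam * g.x2}
  one_mem' := by simp [one_def]
  mul_mem' {a b} ha hb := by
    simp only [Set.mem_ofPred_eq, mul_def] at *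
    rw [ha, hb, mul_add]
  inv_mem' {a} ha := by
    simp only [Set.mem_ofPred_eq, inv_def] at *
    rw [ha, mul_neg]

end G4

theorem AddSubgroup.eq_top_of_uIcc_subset {T : AddSubgroup ℝ} {c : ℝ} (hc : c ≠ 0)
    (hT : Set.uIcc 0 c ⊆ T) : T = ⊤ := by
  refine eq_top_iff.2 fun t _ => ?_
  have hfract : Int.fract (t / c) * c ∈ T := by
    refine hT ?_
    have h0 := Int.fract_nonneg (t / c)
    have h1 := (Int.fract_lt_one (t / c)).le
    rcases le_total 0 c with hc0 | hc0
    · rw [Set.uIcc_of_le hc0]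
      constructor <;> nlinarith
    · rw [Set.uIcc_of_ge hc0]
      constructor <;> nlinarith
  have hfloor : ⌊t / c⌋ • c ∈ T := T.zsmul_mem (hT Set.right_mem_uIcc) _
  have ht : t = ⌊t / c⌋ • c + Int.fract (t / c) * c := by
    rw [zsmul_eq_mul, ← add_mul, Int.floor_add_fract, div_mul_cancel₀ t hc]
  rw [ht]
  exact T.add_mem hfloor hfract

theorem exists_map_add_ne_of_not_linear {h : ℝ → ℝ} (hh : Continuous h)
    (hlin : ¬ ∃ lam : ℝ, ∀ x : ℝ, h x = lam * x) :
    ∃ a b : ℝ, h (a + b) ≠ h a + h b := by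
  contrapose! hlin
  refine ⟨h 1, fun x => ?_⟩
  have hx := map_real_smul (AddMonoidHom.mk' h hlin) hh x 1
  simpa [mul_comm] using hx

/-- For a continuous `h : ℝ → ℝ` with `h(0) = 0`, the subgroup of `G₄` generated by the
set `{(h(x), x, y − x·h(x), z − y·h(x) + ½ x·h(x)²) : x, y, z ∈ ℝ}` equals the whole
group `G₄` if and only if `h` is non-linear, i.e. there is no `λ ∈ ℝ` with
`h(x) = λx` for all `x`. -/
theorem section_generates_G4_iff_nonlinear (h : ℝ → ℝ) (hh : Continuous h)
    (hh0 : h 0 = 0) :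
    Subgroup.closure {g : G4 | ∃ x y z : ℝ,
        g = ⟨h x, x, y - x * h x, z - y * h x + (1/2) * x * (h x) ^ 2⟩} = ⊤ ↔
      ¬ ∃ lam : ℝ, ∀ x : ℝ, h x = lam * x := by
  set S := {g : G4 | ∃ x y z : ℝ,
    g = ⟨h x, x, y - x * h x, z - y * h x + (1/2) * x * (h x) ^ 2⟩}
  constructor
  · rintro htop ⟨lam, hlam⟩
    have hle : Subgroup.closure S ≤ G4.linearSubgroup lam := by
      rw [Subgroup.closure_le]
      rintro _ ⟨x, y, z, rfl⟩
      exact hlam x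
    have hmem : (⟨1, 0, 0, 0⟩ : G4) ∈ G4.linearSubgroup lam :=
      hle (htop ▸ Subgroup.mem_top _)
    have h10 : (1 : ℝ) = lam * 0 := hmem
    simp at h10
  · intro hlin
    set K := Subgroup.closure S
    have hgraph (x : ℝ) :
        (⟨h x, x, 0 - x * h x, 0 - 0 * h x + (1/2) * x * (h x) ^ 2⟩ : G4) ∈ K :=
      Subgroup.subset_closure ⟨x, 0, 0, rfl⟩
    have hK (u v : ℝ) : (⟨0, 0, u, v⟩ : G4) ∈ K :=
      Subgroup.subset_closure ⟨0, u, v, by simp [hh0]⟩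
    obtain ⟨a, b, hab⟩ := exists_map_add_ne_of_not_linear hh hlin
    have hdefect (y : ℝ) : h (a + y) - (h a + h y) ∈ G4.firstAxis K := by
      have hy := G4.mk_mem_of_mem hK (K.mul_mem (hgraph (a + y))
        (K.inv_mem (K.mul_mem (hgraph a) (hgraph y)))) 0 0
      rw [G4.mem_firstAxis]
      simpa only [G4.mul_def, G4.inv_def, ← sub_eq_add_neg, sub_self] using hy
    have haxis : G4.firstAxis K = ⊤ := by
      refine AddSubgroup.eq_top_of_uIcc_subset (sub_ne_zero.2 hab) ?_
      have hcont : Continuous fun y => h (a + y) - (h a + h y) := by fun_prop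
      have hivt := intermediate_value_uIcc (a := 0) (b := b) hcont.continuousOn
      simp only [add_zero, hh0, sub_self] at hivt
      intro t ht
      obtain ⟨y, -, rfl⟩ := hivt ht
      exact hdefect y
    refine eq_top_iff.2 fun p _ => ?_
    have haxis_mem : p.x1 - h p.x2 ∈ G4.firstAxis K := haxis ▸ AddSubgroup.mem_top _
    have hp := G4.mk_mem_of_mem hK
      (K.mul_mem (G4.mem_firstAxis.1 haxis_mem) (hgraph p.x2)) p.x3 p.x4
    simpa only [G4.mul_def, sub_add_cancel, zero_add] using hp
end

section
/- Let h : ℝ² → ℝ be a continuous function. The real vector space spanned by all translates T_{(a₁,a₂)}h, where T_{(a₁,a₂)}h(x,y) = h(x+a₁, y+a₂) for (a₁,a₂) ∈ ℝ², is finite-dimensional if and only if h is a finite real linear combination of functions of the form (x,y) ↦ x^{q₁} y^{q₂} (k₁ e^{λ₁x} + c₁ e^{a₁x} sin(b₁x) + d₁ e^{a₁x} cos(b₁x)) · (k₂ e^{λ₂y} + c₂ e^{a₂y} sin(b₂y) + d₂ e^{a₂y} cos(b₂y)), where q₁, q₂ are nonnegative integers and λᵢ, aᵢ, bᵢ, cᵢ,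 dᵢ, kᵢ ∈ ℝ for i = 1, 2. -/
open Real

/-- The translation of `h : ℝ² → ℝ` by `(a₁,a₂)`: `(x,y) ↦ h(x+a₁, y+a₂)`. -/
noncomputable def translateFn (h : ℝ × ℝ → ℝ) (a : ℝ × ℝ) : ℝ × ℝ → ℝ :=
  fun p => h (p.1 + a.1, p.2 + a.2)

/-- The set of "exponential polynomial" building blocks
`(x,y) ↦ x^{q₁} y^{q₂} (k₁e^{λ₁x} + c₁e^{a₁x}sin(b₁x) + d₁e^{a₁x}cos(b₁x)) ·
(k₂e^{λ₂y} + c₂e^{a₂y}sin(b₂y) + d₂e^{a₂y}cos(b₂y))`. -/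
noncomputable def expPolyBlocks : Set (ℝ × ℝ → ℝ) :=
  {g | ∃ (q₁ q₂ : ℕ) (l₁ l₂ a₁ a₂ b₁ b₂ c₁ c₂ d₁ d₂ k₁ k₂ : ℝ),
    g = fun p => p.1 ^ q₁ * p.2 ^ q₂ *
      (k₁ * exp (l₁ * p.1) + c₁ * exp (a₁ * p.1) * sin (b₁ * p.1) +
        d₁ * exp (a₁ * p.1) * cos (b₁ * p.1)) *
      (k₂ * exp (l₂ * p.2) + c₂ * exp (a₂ * p.2) * sin (b₂ * p.2) +
        d₂ * exp (a₂ * p.2) * cos (b₂ * p.2))}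

open Polynomial in
theorem Polynomial.exists_derivative_eq {K : Type*} [Field K] [CharZero K] (P : K[X]) :
    ∃ Q : K[X], derivative Q = P := by
  induction P using Polynomial.induction_on' with
  | add p q hp hq =>
    obtain ⟨a, rfl⟩ := hp
    obtain ⟨b, rfl⟩ := hq
    exact ⟨a + b, derivative_add⟩
  | monomial n c =>
    refine ⟨monomial (n + 1) (c / (n + 1)), ?_⟩
    have : (n : K) + 1 ≠ 0 := Nat.cast_add_one_ne_zero n
    rw [derivative_monomial]
    simp [this]

/-- A subspace of functions on an additive group that is stable under translations. -/
def IsTranslationInvariant {K G : Type*} [Field K] [Add G] (V : Submodule K (G → K)) : Prop :=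
  ∀ f ∈ V, ∀ a, (fun x => f (x + a)) ∈ V

/-- A finite-dimensional space of functions is determined by its values at finitely many points. -/
theorem exists_finset_interpolation {K X : Type*} [Field K] (V : Submodule K (X → K))
    [FiniteDimensional K V] :
    ∃ (S : Finset X) (e : S → X → K), (∀ p, e p ∈ V) ∧
      ∀ f ∈ V, ∀ x, f x = ∑ p : S, f p * e p x := by
  classical
  obtain ⟨S, hS⟩ := Finset.exists_inf_le
    (fun x : X => LinearMap.ker ((LinearMap.proj x : (X → K) →ₗ[K] K) ∘ₗ V.subtype))
  let r : V →ₗ[K] (S → K) := LinearMap.funLeft K K (fun p : S => (p : X)) ∘ₗ V.subtype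
  have hr : LinearMap.ker r = ⊥ := by
    refine (Submodule.eq_bot_iff _).2 fun f hf => ?_
    have hf' : f ∈ S.inf
        (fun x : X => LinearMap.ker ((LinearMap.proj x : (X → K) →ₗ[K] K) ∘ₗ V.subtype)) := by
      rw [Submodule.mem_finsetInf]
      intro p hp
      exact congrFun (LinearMap.mem_ker.1 hf) ⟨p, hp⟩
    ext x
    exact LinearMap.mem_ker.1 (hS x hf')
  obtain ⟨g, hg⟩ := r.exists_leftInverse_of_injective hr
  refine ⟨S, fun p => g (Pi.single p 1), fun p => (g _).2, fun f hf x => ?_⟩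
  have h1 : g (r ⟨f, hf⟩) = ⟨f, hf⟩ := LinearMap.congr_fun hg _
  have h2 : r ⟨f, hf⟩ = ∑ p : S, f p • (Pi.single p 1 : S → K) := by
    ext p
    simp [r, Finset.sum_apply, Pi.single_apply, LinearMap.funLeft_apply]
  rw [h2, map_sum] at h1
  have h3 := congrArg (fun v : V => (v : X → K) x) h1
  simpa [Finset.sum_apply] using h3.symm

/-- If all increments of `F` lie in a finite-dimensional space, so does its derivative. -/
theorem mem_of_hasDerivAt_of_increment_mem (W : Submodule ℂ (ℝ → ℂ)) [FiniteDimensional ℂ W]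
    {F f : ℝ → ℂ} (hF : ∀ x, HasDerivAt F (f x) x)
    (hW : ∀ t, (fun x => F (x + t) - F x) ∈ W) : f ∈ W := by
  have hlim : Filter.Tendsto (fun t : ℝ => (fun x => t⁻¹ • (F (x + t) - F x)))
      (nhdsWithin 0 {0}ᶜ) (nhds f) :=
    tendsto_pi_nhds.2 fun x => hasDerivAt_iff_tendsto_slope_zero.1 (hF x)
  refine W.closed_of_finiteDimensional.mem_of_tendsto hlim (Filter.Eventually.of_forall fun t => ?_)
  have h := W.smul_mem ((t⁻¹ : ℝ) : ℂ) (hW t)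
  rwa [Complex.coe_smul] at h

theorem differentiable_of_isTranslationInvariant (V : Submodule ℂ (ℝ → ℂ))
    [FiniteDimensional ℂ V] (hinv : IsTranslationInvariant V) (hcont : ∀ f ∈ V, Continuous f)
    {f : ℝ → ℂ} (hf : f ∈ V) : Differentiable ℝ f := by
  let W : Submodule ℂ (ℝ → ℂ) :=
    { carrier := {f | f ∈ V ∧ Differentiable ℝ f}
      add_mem' := fun ha hb => ⟨V.add_mem ha.1 hb.1, ha.2.add hb.2⟩
      zero_mem' := ⟨V.zero_mem, differentiable_const 0⟩
      smul_mem' := fun c _ ha => ⟨V.smul_mem c ha.1, ha.2.const_smul c⟩ }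
  have hWV : W ≤ V := fun _ h => h.1
  have : FiniteDimensional ℂ W := Submodule.finiteDimensional_of_le hWV
  obtain ⟨S, e, he, hS⟩ := exists_finset_interpolation V
  have hfc := hcont f hf
  have hF : ∀ x, HasDerivAt (fun u => ∫ a in (0 : ℝ)..u, f a) (f x) x := fun x =>
    (hfc.integral_hasStrictDerivAt 0 x).hasDerivAt
  refine (mem_of_hasDerivAt_of_increment_mem W hF fun t => ⟨?_, ?_⟩).2
  · have : (fun x => (∫ a in (0 : ℝ)..(x + t), f a) - ∫ a in (0 : ℝ)..x, f a) =
        ∑ p : S, (∫ a in (0 : ℝ)..t, f (p + a)) • e p := by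
      ext x
      rw [intervalIntegral.integral_interval_sub_left (hfc.intervalIntegrable _ _)
        (hfc.intervalIntegrable _ _)]
      have h1 := intervalIntegral.integral_comp_add_left (a := 0) (b := t) f x
      rw [add_zero] at h1
      rw [← h1]
      simp_rw [fun a => hS _ (hinv f hf a) x]
      rw [intervalIntegral.integral_finsetSum
        fun p _ => Continuous.intervalIntegrable (by fun_prop) _ _]
      simp [Finset.sum_apply]
    rw [this]
    exact V.sum_mem fun p _ => V.smul_mem _ (he p)
  · have hd : Differentiable ℝ (fun u => ∫ a in (0 : ℝ)..u, f a) :=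
      fun x => (hF x).differentiableAt
    exact (hd.comp (differentiable_id.add_const t)).sub hd

theorem deriv_mem_of_isTranslationInvariant (V : Submodule ℂ (ℝ → ℂ))
    [FiniteDimensional ℂ V] (hinv : IsTranslationInvariant V) (hcont : ∀ f ∈ V, Continuous f)
    {f : ℝ → ℂ} (hf : f ∈ V) : deriv f ∈ V :=
  mem_of_hasDerivAt_of_increment_mem V
    (fun x => (differentiable_of_isTranslationInvariant V hinv hcont hf x).hasDerivAt)
    fun t => V.sub_mem (hinv f hf t) hf

/-- Solutions of `(D - μ)ᵏ f = 0` are polynomial multiples of `e^{μx}`. -/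
theorem exists_polynomial_mul_cexp {V : Submodule ℂ (ℝ → ℂ)}
    (hdiff : ∀ f ∈ V, Differentiable ℝ f) (D : Module.End ℂ V)
    (hD : ∀ f : V, (D f : ℝ → ℂ) = deriv (f : ℝ → ℂ)) (μ : ℂ) (k : ℕ) (f : V)
    (hf : ((D - μ • 1) ^ k) f = 0) :
    ∃ P : Polynomial ℂ, ∀ x : ℝ, (f : ℝ → ℂ) x = P.eval (x : ℂ) * Complex.exp (μ * x) := by
  induction k generalizing f with
  | zero =>
    have hf0 : f = 0 := by simpa using hf
    exact ⟨0, fun x => by simp [hf0]⟩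
  | succ k ih =>
    rw [pow_succ] at hf
    obtain ⟨P, hP⟩ := ih ((D - μ • 1) f) hf
    obtain ⟨Q, hQ⟩ := P.exists_derivative_eq
    have hexp (ν : ℂ) (x : ℝ) :
        HasDerivAt (fun x : ℝ => Complex.exp (ν * x)) (Complex.exp (ν * x) * ν) x := by
      simpa using ((Complex.ofRealCLM.hasDerivAt (x := x)).const_mul ν).cexp
    have hfd (x : ℝ) : HasDerivAt (f : ℝ → ℂ)
        (P.eval (x : ℂ) * Complex.exp (μ * x) + μ * (f : ℝ → ℂ) x) x := by
      have h1 := (hdiff f f.2 x).hasDerivAt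
      have h2 := hP x
      simp only [LinearMap.sub_apply, Submodule.coe_sub, Pi.sub_apply, hD] at h2
      simp only [LinearMap.smul_apply, Module.End.one_apply, Submodule.coe_smul, Pi.smul_apply,
        smul_eq_mul] at h2
      rwa [← h2, sub_add_cancel]
    have hconst (x : ℝ) : HasDerivAt
        (fun x : ℝ => (f : ℝ → ℂ) x * Complex.exp (-μ * x) - Q.eval (x : ℂ)) 0 x := by
      have hQd : HasDerivAt (fun x : ℝ => Q.eval (x : ℂ)) (P.eval (x : ℂ)) x := by
        rw [← hQ]
        exact (Q.hasDerivAt (x : ℂ)).comp_ofReal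
      refine (((hfd x).fun_mul (hexp (-μ) x)).fun_sub hQd).congr_deriv ?_
      have : Complex.exp (μ * x) * Complex.exp (-μ * x) = 1 := by
        rw [← Complex.exp_add]; simp
      linear_combination P.eval (x : ℂ) * this
    have hc := is_const_of_deriv_eq_zero (fun x => (hconst x).differentiableAt)
      (fun x => (hconst x).deriv)
    refine ⟨Q + Polynomial.C ((f : ℝ → ℂ) 0 * Complex.exp (-μ * (0 : ℝ)) - Q.eval ((0 : ℝ) : ℂ)),
      fun x => ?_⟩
    rw [Polynomial.eval_add, Polynomial.eval_C, ← hc x 0]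
    have : Complex.exp (μ * x) * Complex.exp (-μ * x) = 1 := by
      rw [← Complex.exp_add]; simp
    linear_combination (-(f : ℝ → ℂ) x) * this

/-- The complex exponential monomials `x ↦ x^q e^{zx}` on the real line. -/
def cexpMonomials : Set (ℝ → ℂ) :=
  {g | ∃ (q : ℕ) (z : ℂ), g = fun x : ℝ => (x : ℂ) ^ q * Complex.exp (z * x)}

theorem mem_span_cexpMonomials (V : Submodule ℂ (ℝ → ℂ))
    [FiniteDimensional ℂ V] (hinv : IsTranslationInvariant V) (hcont : ∀ f ∈ V, Continuous f)
    {f : ℝ → ℂ} (hf : f ∈ V) : f ∈ Submodule.span ℂ cexpMonomials := by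
  have hdiff : ∀ f ∈ V, Differentiable ℝ f := fun f hf =>
    differentiable_of_isTranslationInvariant V hinv hcont hf
  let D : Module.End ℂ V :=
    { toFun := fun f => ⟨deriv (f : ℝ → ℂ), deriv_mem_of_isTranslationInvariant V hinv hcont f.2⟩
      map_add' := fun f g => by
        ext x
        exact deriv_add (hdiff f f.2 x) (hdiff g g.2 x)
      map_smul' := fun c f => by
        ext x
        exact deriv_const_smul c (hdiff f f.2 x) }
  have htop : (⟨f, hf⟩ : V) ∈ ⨆ μ, D.maxGenEigenspace μ := by
    rw [Module.End.iSup_maxGenEigenspace_eq_top]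
    trivial
  refine Submodule.iSup_induction _
    (motive := fun g : V => (g : ℝ → ℂ) ∈ Submodule.span ℂ cexpMonomials) htop ?_
    (Submodule.zero_mem _) fun _ _ h₁ h₂ => Submodule.add_mem _ h₁ h₂
  intro μ g hg
  obtain ⟨k, hk⟩ := (Module.End.mem_maxGenEigenspace _ _ _).1 hg
  obtain ⟨P, hP⟩ := exists_polynomial_mul_cexp hdiff D (fun _ => rfl) μ k g hk
  have hsum : (g : ℝ → ℂ) = ∑ i ∈ Finset.range (P.natDegree + 1),
      P.coeff i • fun x : ℝ => (x : ℂ) ^ i * Complex.exp (μ * x) := by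
    ext x
    rw [hP, Polynomial.eval_eq_sum_range, Finset.sum_mul]
    simp [Finset.sum_apply, mul_assoc]
  rw [hsum]
  exact Submodule.sum_mem _ fun i _ =>
    Submodule.smul_mem _ _ (Submodule.subset_span ⟨i, μ, rfl⟩)

/-- Restricting a finite-dimensional translation-invariant space of functions on the plane to an
affine line gives exponential polynomials. -/
theorem comp_line_mem_span_cexpMonomials (W : Submodule ℂ (ℝ × ℝ → ℂ)) [FiniteDimensional ℂ W]
    (hinv : IsTranslationInvariant W) (hcont : ∀ f ∈ W, Continuous f) (c : ℝ × ℝ)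
    (φ : ℝ →+ ℝ × ℝ) (hφ : Continuous φ) {f : ℝ × ℝ → ℂ} (hf : f ∈ W) :
    (fun x => f (c + φ x)) ∈ Submodule.span ℂ cexpMonomials := by
  refine mem_span_cexpMonomials (W.map (LinearMap.funLeft ℂ ℂ fun x => c + φ x)) ?_ ?_
    (Submodule.mem_map_of_mem hf)
  · rintro _ ⟨g, hg, rfl⟩ a
    refine ⟨fun p => g (p + φ a), hinv g hg _, ?_⟩
    ext x
    simp [LinearMap.funLeft_apply, add_assoc]
  · rintro _ ⟨g, hg, rfl⟩
    exact (hcont g hg).comp (continuous_const.add hφ)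

/-- Products of a complex exponential monomial in each of two real variables. -/
def cexpMonomials₂ : Set (ℝ × ℝ → ℂ) :=
  {g | ∃ u ∈ cexpMonomials, ∃ v ∈ cexpMonomials, g = fun p => u p.1 * v p.2}

theorem mul_mem_span_cexpMonomials₂ {u v : ℝ → ℂ} (hu : u ∈ Submodule.span ℂ cexpMonomials)
    (hv : v ∈ Submodule.span ℂ cexpMonomials) :
    (fun p : ℝ × ℝ => u p.1 * v p.2) ∈ Submodule.span ℂ cexpMonomials₂ := by
  let B : (ℝ → ℂ) →ₗ[ℂ] (ℝ → ℂ) →ₗ[ℂ] (ℝ × ℝ → ℂ) :=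
    (LinearMap.mul ℂ (ℝ × ℝ → ℂ)).compl₁₂ (LinearMap.funLeft ℂ ℂ Prod.fst)
      (LinearMap.funLeft ℂ ℂ Prod.snd)
  have h := Submodule.apply_mem_map₂ B hu hv
  rw [Submodule.map₂_span_span] at h
  refine Submodule.span_mono ?_ h
  rintro _ ⟨u, hu, v, hv, rfl⟩
  exact ⟨u, hu, v, hv, rfl⟩

theorem mem_span_cexpMonomials₂ (W : Submodule ℂ (ℝ × ℝ → ℂ)) [FiniteDimensional ℂ W]
    (hinv : IsTranslationInvariant W) (hcont : ∀ f ∈ W, Continuous f) {f : ℝ × ℝ → ℂ}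
    (hf : f ∈ W) : f ∈ Submodule.span ℂ cexpMonomials₂ := by
  obtain ⟨S, e, he, hS⟩ := exists_finset_interpolation W
  have hsum : f = ∑ p : S, fun q : ℝ × ℝ =>
      e p (0 + AddMonoidHom.inl ℝ ℝ q.1) * f (p + AddMonoidHom.inr ℝ ℝ q.2) := by
    ext q
    have h := hS _ (hinv f hf (0, q.2)) (q.1, 0)
    simp only [Prod.mk_add_mk, add_zero, zero_add] at h
    rw [Finset.sum_apply, h]
    refine Finset.sum_congr rfl fun p _ => ?_
    simp [mul_comm]
  rw [hsum]
  refine Submodule.sum_mem _ fun p _ => mul_mem_span_cexpMonomials₂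
    (u := fun x => e p (0 + AddMonoidHom.inl ℝ ℝ x))
    (v := fun y => f (p + AddMonoidHom.inr ℝ ℝ y)) ?_ ?_
  · exact comp_line_mem_span_cexpMonomials W hinv hcont _ _
      (continuous_id.prodMk continuous_const) (he p)
  · exact comp_line_mem_span_cexpMonomials W hinv hcont _ _
      (continuous_const.prodMk continuous_id) hf

theorem re_mem_span_expPolyBlocks {f : ℝ × ℝ → ℂ} (hf : f ∈ Submodule.span ℂ cexpMonomials₂) :
    (fun p => (f p).re) ∈ Submodule.span ℝ expPolyBlocks := by
  suffices h : ∀ c : ℂ, (fun p => (c * f p).re) ∈ Submodule.span ℝ expPolyBlocks by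
    simpa using h 1
  induction hf using Submodule.span_induction with
  | mem f hf =>
    intro c
    obtain ⟨_, ⟨q, z, rfl⟩, _, ⟨r, w, rfl⟩, rfl⟩ := hf
    have key : (fun p : ℝ × ℝ => (c * ((p.1 : ℂ) ^ q * Complex.exp (z * p.1) *
        ((p.2 : ℂ) ^ r * Complex.exp (w * p.2)))).re) =
        (fun p : ℝ × ℝ => p.1 ^ q * p.2 ^ r *
          (0 * exp (0 * p.1) + 0 * exp (z.re * p.1) * sin (z.im * p.1) +
            1 * exp (z.re * p.1) * cos (z.im * p.1)) *
          (0 * exp (0 * p.2) + (-c.im) * exp (w.re * p.2) * sin (w.im * p.2) +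
            c.re * exp (w.re * p.2) * cos (w.im * p.2))) +
        (fun p : ℝ × ℝ => p.1 ^ q * p.2 ^ r *
          (0 * exp (0 * p.1) + (-1) * exp (z.re * p.1) * sin (z.im * p.1) +
            0 * exp (z.re * p.1) * cos (z.im * p.1)) *
          (0 * exp (0 * p.2) + c.re * exp (w.re * p.2) * sin (w.im * p.2) +
            c.im * exp (w.re * p.2) * cos (w.im * p.2))) := by
      ext p
      have h1 : ((p.1 : ℂ) ^ q * Complex.exp (z * p.1) *
          ((p.2 : ℂ) ^ r * Complex.exp (w * p.2))) =
          ((p.1 ^ q * p.2 ^ r : ℝ) : ℂ) * (Complex.exp (z * p.1) * Complex.exp (w * p.2)) := by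
        push_cast
        ring
      rw [h1, mul_left_comm, Complex.re_ofReal_mul]
      simp [Complex.mul_re, Complex.mul_im, Complex.exp_re, Complex.exp_im]
      ring
    rw [key]
    exact Submodule.add_mem _ (Submodule.subset_span ⟨q, r, _, _, _, _, _, _, _, _, _, _, _, _, rfl⟩)
      (Submodule.subset_span ⟨q, r, _, _, _, _, _, _, _, _, _, _, _, _, rfl⟩)
  | zero =>
    intro c
    simp only [Pi.zero_apply, mul_zero, Complex.zero_re]
    exact (Submodule.span ℝ expPolyBlocks).zero_mem
  | add f g _ _ hf hg =>
    intro c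
    simpa [mul_add] using! Submodule.add_mem _ (hf c) (hg c)
  | smul a f _ hf =>
    intro c
    simpa [mul_assoc] using hf (c * a)

theorem mem_span_expPolyBlocks (V : Submodule ℝ (ℝ × ℝ → ℝ)) [FiniteDimensional ℝ V]
    (hinv : IsTranslationInvariant V) (hcont : ∀ f ∈ V, Continuous f) {f : ℝ × ℝ → ℝ}
    (hf : f ∈ V) : f ∈ Submodule.span ℝ expPolyBlocks := by
  obtain ⟨S, hS⟩ := (Submodule.fg_iff_finiteDimensional V).2 ‹_›
  let ι : (ℝ × ℝ → ℝ) → (ℝ × ℝ → ℂ) := fun g p => (g p : ℂ)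
  let W : Submodule ℂ (ℝ × ℝ → ℂ) := Submodule.span ℂ (ι '' S)
  have : FiniteDimensional ℂ W := FiniteDimensional.span_of_finite ℂ (S.finite_toSet.image ι)
  have hSV : ∀ g ∈ S, g ∈ V := fun g hg => hS ▸ Submodule.subset_span hg
  have hιW : ∀ g ∈ V, ι g ∈ W := by
    intro g hg
    rw [← hS] at hg
    induction hg using Submodule.span_induction with
    | mem g hg => exact Submodule.subset_span ⟨g, hg, rfl⟩
    | zero => convert W.zero_mem; simp [ι]; rfl
    | add g₁ g₂ _ _ h₁ h₂ => convert W.add_mem h₁ h₂; ext p; simp [ι]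
    | smul a g _ h => convert W.smul_mem (a : ℂ) h; ext p; simp [ι]
  have hWinv : IsTranslationInvariant W := by
    intro g hg a
    induction hg using Submodule.span_induction with
    | mem _ hg =>
      obtain ⟨g, hg, rfl⟩ := hg
      exact hιW _ (hinv g (hSV g hg) a)
    | zero => exact W.zero_mem
    | add _ _ _ _ h₁ h₂ => exact W.add_mem h₁ h₂
    | smul c _ _ h => exact W.smul_mem c h
  have hWcont : ∀ g ∈ W, Continuous g := by
    intro g hg
    induction hg using Submodule.span_induction with
    | mem _ hg =>
      obtain ⟨g, hg, rfl⟩ := hg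
      exact Complex.continuous_ofReal.comp (hcont g (hSV g hg))
    | zero => exact continuous_const
    | add _ _ _ _ h₁ h₂ => exact h₁.add h₂
    | smul c _ _ h => exact h.const_smul c
  exact re_mem_span_expPolyBlocks (mem_span_cexpMonomials₂ W hWinv hWcont (hιW f hf))

/-- The algebra of functions contained in a finite-dimensional translation-invariant space. -/
def translationFinite (K G : Type*) [Field K] [Add G] : Subalgebra K (G → K) where
  carrier := {f | ∃ V : Submodule K (G → K), V.FG ∧ IsTranslationInvariant V ∧ f ∈ V}
  add_mem' := by
    rintro f g ⟨V, hV, hVi, hf⟩ ⟨W, hW, hWi, hg⟩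
    refine ⟨V ⊔ W, hV.sup hW, fun u hu a => ?_, Submodule.add_mem_sup hf hg⟩
    obtain ⟨v, hv, w, hw, rfl⟩ := Submodule.mem_sup.1 hu
    exact Submodule.add_mem_sup (hVi v hv a) (hWi w hw a)
  mul_mem' := by
    rintro f g ⟨V, hV, hVi, hf⟩ ⟨W, hW, hWi, hg⟩
    refine ⟨V * W, hV.mul hW, fun u hu a => ?_, Submodule.mul_mem_mul hf hg⟩
    induction hu using Submodule.mul_induction_on' with
    | mem_mul_mem v hv w hw => exact Submodule.mul_mem_mul (hVi v hv a) (hWi w hw a)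
    | add _ _ _ _ h₁ h₂ => exact Submodule.add_mem _ h₁ h₂
  algebraMap_mem' c := by
    refine ⟨Submodule.span K {1}, Submodule.fg_span_singleton _, fun u hu a => ?_,
      Submodule.mem_span_singleton.2 ⟨c, by ext; simp⟩⟩
    obtain ⟨d, rfl⟩ := Submodule.mem_span_singleton.1 hu
    exact Submodule.mem_span_singleton.2 ⟨d, rfl⟩

theorem subset_translationFinite {K G : Type*} [Field K] [Add G] {s : Set (G → K)}
    (hs : s.Finite) (h : ∀ f ∈ s, ∀ a, (fun x => f (x + a)) ∈ Submodule.span K s) :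
    ∀ f ∈ s, f ∈ translationFinite K G := by
  refine fun f hf => ⟨Submodule.span K s, Submodule.fg_span hs, fun u hu a => ?_,
    Submodule.subset_span hf⟩
  induction hu using Submodule.span_induction with
  | mem g hg => exact h g hg a
  | zero => exact Submodule.zero_mem _
  | add _ _ _ _ h₁ h₂ => exact Submodule.add_mem _ h₁ h₂
  | smul c _ _ h => exact Submodule.smul_mem _ c h

section generators

variable (φ : ℝ × ℝ →+ ℝ)

theorem addMonoidHom_mem_translationFinite : ⇑φ ∈ translationFinite ℝ (ℝ × ℝ) := by
  refine subset_translationFinite (s := {⇑φ, 1}) (Set.toFinite _) ?_ _ (by simp)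
  rintro f (rfl | rfl) a
  · refine Submodule.mem_span_pair.2 ⟨1, φ a, ?_⟩
    ext x
    simp
  · exact Submodule.subset_span (by simp [Pi.one_def])

theorem exp_mem_translationFinite (l : ℝ) :
    (fun p => exp (l * φ p)) ∈ translationFinite ℝ (ℝ × ℝ) := by
  refine subset_translationFinite (s := {fun p => exp (l * φ p)}) (Set.toFinite _) ?_ _ (by simp)
  rintro f rfl a
  refine Submodule.mem_span_singleton.2 ⟨exp (l * φ a), ?_⟩
  ext x
  simp [mul_add, exp_add, mul_comm]

theorem sin_cos_mem_translationFinite (b : ℝ) :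
    (fun p => sin (b * φ p)) ∈ translationFinite ℝ (ℝ × ℝ) ∧
      (fun p => cos (b * φ p)) ∈ translationFinite ℝ (ℝ × ℝ) := by
  have h : ∀ f ∈ ({fun p => sin (b * φ p), fun p => cos (b * φ p)} : Set (ℝ × ℝ → ℝ)),
      f ∈ translationFinite ℝ (ℝ × ℝ) := by
    refine subset_translationFinite (Set.toFinite _) ?_
    rintro f (rfl | rfl) a
    · refine Submodule.mem_span_pair.2 ⟨cos (b * φ a), sin (b * φ a), ?_⟩
      ext x
      simp [mul_add, sin_add]
      ring
    · refine Submodule.mem_span_pair.2 ⟨-sin (b * φ a), cos (b * φ a), ?_⟩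
      ext x
      simp [mul_add, cos_add]
      ring
  exact ⟨h _ (by simp), h _ (by simp)⟩

theorem expTrig_mem_translationFinite (k l c a b d : ℝ) :
    (fun p => k * exp (l * φ p) + c * exp (a * φ p) * sin (b * φ p) +
      d * exp (a * φ p) * cos (b * φ p)) ∈ translationFinite ℝ (ℝ × ℝ) := by
  have hk (k : ℝ) : (fun _ => k) ∈ translationFinite ℝ (ℝ × ℝ) :=
    Subalgebra.algebraMap_mem _ k
  have hs := sin_cos_mem_translationFinite φ b
  have he := exp_mem_translationFinite φ
  exact add_mem (add_mem (mul_mem (hk k) (he l)) (mul_mem (mul_mem (hk c) (he a)) hs.1))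
    (mul_mem (mul_mem (hk d) (he a)) hs.2)

end generators

theorem span_expPolyBlocks_le :
    Submodule.span ℝ expPolyBlocks ≤
      Subalgebra.toSubmodule (translationFinite ℝ (ℝ × ℝ)) := by
  refine Submodule.span_le.2 ?_
  rintro _ ⟨q₁, q₂, l₁, l₂, a₁, a₂, b₁, b₂, c₁, c₂, d₁, d₂, k₁, k₂, rfl⟩
  have h₁ := addMonoidHom_mem_translationFinite (AddMonoidHom.fst ℝ ℝ)
  have h₂ := addMonoidHom_mem_translationFinite (AddMonoidHom.snd ℝ ℝ)
  rw [SetLike.mem_coe, Subalgebra.mem_toSubmodule]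
  exact mul_mem (mul_mem (mul_mem (pow_mem h₁ q₁) (pow_mem h₂ q₂))
    (expTrig_mem_translationFinite (AddMonoidHom.fst ℝ ℝ) k₁ l₁ c₁ a₁ b₁ d₁))
    (expTrig_mem_translationFinite (AddMonoidHom.snd ℝ ℝ) k₂ l₂ c₂ a₂ b₂ d₂)

/-- For a continuous `h : ℝ² → ℝ`, the real vector space spanned by all translates
`T_{(a₁,a₂)}h` is finite-dimensional if and only if `h` is a finite real linear
combination of the functions in `expPolyBlocks`. -/
theorem finiteDimensional_span_translates_iff (h : ℝ × ℝ → ℝ) (hh : Continuous h) :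
    FiniteDimensional ℝ
        ↥(Submodule.span ℝ {g : ℝ × ℝ → ℝ | ∃ a : ℝ × ℝ, g = translateFn h a}) ↔
      h ∈ Submodule.span ℝ expPolyBlocks := by
  constructor
  · intro hfin
    refine mem_span_expPolyBlocks (Submodule.span ℝ {g | ∃ a, g = translateFn h a}) (fun f hf a => ?_) (fun f hf => ?_)
      (Submodule.subset_span ⟨0, by ext p; simp [translateFn]⟩)
    · induction hf using Submodule.span_induction with
      | mem _ hf =>
        obtain ⟨b, rfl⟩ := hf
        exact Submodule.subset_span ⟨a + b, by ext p; simp [translateFn, add_assoc]⟩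
      | zero => exact Submodule.zero_mem _
      | add _ _ _ _ h₁ h₂ => exact Submodule.add_mem _ h₁ h₂
      | smul c _ _ h => exact Submodule.smul_mem _ c h
    · induction hf using Submodule.span_induction with
      | mem _ hf =>
        obtain ⟨b, rfl⟩ := hf
        unfold translateFn
        fun_prop
      | zero => exact continuous_const
      | add _ _ _ _ h₁ h₂ => exact h₁.add h₂
      | smul c _ _ h => exact h.const_smul c
  · intro hmem
    obtain ⟨V, hV, hinv, hhV⟩ := span_expPolyBlocks_le hmem
    have : FiniteDimensional ℝ V := (Submodule.fg_iff_finiteDimensional V).1 hV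
    refine Submodule.finiteDimensional_of_le (S₂ := V) (Submodule.span_le.2 ?_)
    rintro _ ⟨a, rfl⟩
    exact hinv h hhV a
end

section
/- Let v : ℝ³ → ℝ be a continuous function. Then the following are equivalent: (i) for every x₀, z₀, x₁, c ∈ ℝ there exists exactly one y ∈ ℝ with y − x₁·v(x₀, y, z₀) = c; (ii) v does not depend on its second variable, i.e. v(x, y, z) = v(x, y′, z) for all x, y, y′, z. -/
/-- Let `v : ℝ³ → ℝ` be continuous.  Then: for all `x₀, z₀, x₁, c` the equation
`y − x₁·v(x₀, y, z₀) = c` has exactly one solution `y`, if and only if `v` does not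
depend on its second variable. -/
theorem unique_solution_iff_independent_of_second_variable
    (v : ℝ × ℝ × ℝ → ℝ) (hv : Continuous v) :
    (∀ x₀ z₀ x₁ c : ℝ, ∃! y : ℝ, y - x₁ * v (x₀, y, z₀) = c) ↔
      (∀ x y y' z : ℝ, v (x, y, z) = v (x, y', z)) := by
  constructor
  · intro h x y y' z
    by_contra hne
    have hd : v (x, y, z) - v (x, y', z) ≠ 0 := sub_ne_zero.mpr hne
    set a := (y - y') / (v (x, y, z) - v (x, y', z))
    have hslope : a * (v (x, y, z) - v (x, y', z)) = y - y' := div_mul_cancel₀ _ hd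
    have hy : y = y' :=
      (h x z a (y - a * v (x, y, z))).unique rfl (by linarith)
    exact hne (by rw [hy])
  · intro h x₀ z₀ x₁ c
    refine ⟨c + x₁ * v (x₀, 0, z₀), ?_, fun y hy => ?_⟩
    · simp only [h x₀ _ 0 z₀, add_sub_cancel_right]
    · simp only [h x₀ y 0 z₀] at hy
      linarith
end
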